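/- arXiv:0810.5479 — 2 statements merged into one kernel-verified Lean document; each statement's English description precedes it below -/
import Mathlib

section
/- Let B = ⊕_{n≥0} B_n be an integral graded K-algebra that is approximable. Then there exists a ∈ ℕ∖{0} such that for all sufficiently large p, the graded subalgebra ⊕_{n≥0} Im(SⁿB_p → B_{np}) has Krull dimension a. Moreover, setting d(B) = a − 1, the sequence (rank B_n · d(B)! / n^{d(B)})_{n≥1} converges in ℝ₊. -/
open Module Filter

instance LowerSet.wellFoundedLT {α : Type*} [Preorder α] [WellQuasiOrderedLE α] :
    WellFoundedLT (LowerSet α) := by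
  refine ⟨RelEmbedding.wellFounded_iff_isEmpty.2 ?_⟩
  refine ⟨fun f => ?_⟩
  have hf : ∀ n, f (n + 1) < f n := fun n => f.map_rel_iff.2 (Nat.lt_succ_self n)
  have hanti : Antitone f := antitone_nat_of_succ_le fun n => (hf n).le
  choose x hx hx' using fun n => Set.exists_of_ssubset (LowerSet.coe_ssubset_coe.2 (hf n))
  obtain ⟨i, j, hij, hle⟩ := wellQuasiOrdered_le x
  exact hx' i (hanti (Nat.succ_le_of_lt hij) ((f j).lower hle (hx j)))

theorem ringKrullDim_eq_of_isIntegral {R S : Type*} [CommRing R] [CommRing S]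
    [Algebra R S] [Algebra.IsIntegral R S] [FaithfulSMul R S] :
    ringKrullDim S = ringKrullDim R := by
  apply le_antisymm
  · refine Order.krullDim_le_of_strictMono (PrimeSpectrum.comap (algebraMap R S)) ?_
    intro p q hpq
    exact Ideal.IsIntegral.comap_lt_comap hpq
  · refine iSup_le fun l => ?_
    obtain ⟨Q, hQ⟩ := (Algebra.IsIntegral.comap_surjective (R := R) (S := S)) l.head
    have : Q.asIdeal.LiesOver l.head.asIdeal := ⟨congrArg PrimeSpectrum.asIdeal hQ.symm⟩
    obtain ⟨L, hL, -⟩ := Ideal.exists_ltSeries_of_hasGoingUp l Q.asIdeal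
    rw [← hL]
    exact le_iSup (fun p : LTSeries (PrimeSpectrum S) => (p.length : WithBot ℕ∞)) L

section Monomials

/-- The lower set of tails of elements of `L` with vanishing first coordinate. -/
def LowerSet.sliceZero {r : ℕ} (L : LowerSet (Fin (r + 1) →₀ ℕ)) : LowerSet (Fin r →₀ ℕ) where
  carrier := {a | Finsupp.cons 0 a ∈ L}
  lower' := by
    intro a b hba ha
    refine L.lower ?_ ha
    intro i
    refine Fin.cases (by simp) (fun j => ?_) i
    simpa using hba j

/-- The elements whose translate by the first basis vector lies in `L`. -/
def LowerSet.shiftZero {r : ℕ} (L : LowerSet (Fin (r + 1) →₀ ℕ)) :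
    LowerSet (Fin (r + 1) →₀ ℕ) where
  carrier := {a | a + Finsupp.single 0 1 ∈ L}
  lower' := fun _ _ hba ha => L.lower (add_le_add_left hba _) ha

theorem LowerSet.shiftZero_le {r : ℕ} (L : LowerSet (Fin (r + 1) →₀ ℕ)) : L.shiftZero ≤ L :=
  fun _ ha => L.lower le_self_add ha

/-- The number of elements of degree `n` of a set of exponents. -/
noncomputable def degreeCount {r : ℕ} (L : LowerSet (Fin r →₀ ℕ)) (n : ℕ) : ℕ :=
  {a | a ∈ L ∧ a.degree = n}.ncard

theorem finite_degree_eq {r : ℕ} (L : LowerSet (Fin r →₀ ℕ)) (n : ℕ) :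
    {a | a ∈ L ∧ a.degree = n}.Finite :=
  (Finsupp.finite_of_degree_le n).subset fun _ ha => ha.2.le

theorem Finsupp.degree_cons_fin {r : ℕ} (k : ℕ) (a : Fin r →₀ ℕ) :
    (Finsupp.cons k a).degree = k + a.degree := by
  simp [Finsupp.degree_eq_sum, Fin.sum_univ_succ]

theorem image_cons_sliceZero {r : ℕ} (L : LowerSet (Fin (r + 1) →₀ ℕ)) (n : ℕ) :
    Finsupp.cons 0 '' {a | a ∈ L.sliceZero ∧ a.degree = n} =
      {a | (a ∈ L ∧ a.degree = n) ∧ a 0 = 0} := by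
  ext a
  constructor
  · rintro ⟨b, ⟨hb, rfl⟩, rfl⟩
    exact ⟨⟨hb, by simp [Finsupp.degree_cons_fin]⟩, by simp⟩
  · rintro ⟨⟨ha, hn⟩, h0⟩
    have hc : Finsupp.cons 0 a.tail = a := by rw [← h0]; exact Finsupp.cons_tail a
    refine ⟨a.tail, ⟨?_, ?_⟩, hc⟩
    · change Finsupp.cons 0 a.tail ∈ L
      rwa [hc]
    · rw [← hc, Finsupp.degree_cons_fin, zero_add] at hn
      exact hn

theorem degreeCount_zero {r : ℕ} (L : LowerSet (Fin (r + 1) →₀ ℕ)) :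
    degreeCount L 0 = degreeCount L.sliceZero 0 := by
  unfold degreeCount
  rw [← Set.ncard_image_of_injective {a | a ∈ L.sliceZero ∧ _} (Finsupp.cons_right_injective 0),
    image_cons_sliceZero]
  congr 1
  ext a
  simp +contextual [Finsupp.degree_eq_zero_iff]

theorem degreeCount_succ {r : ℕ} (L : LowerSet (Fin (r + 1) →₀ ℕ)) (n : ℕ) :
    degreeCount L (n + 1) = degreeCount L.sliceZero (n + 1) + degreeCount L.shiftZero n := by
  unfold degreeCount
  rw [← Set.ncard_image_of_injective {a | a ∈ L.sliceZero ∧ _} (Finsupp.cons_right_injective 0),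
    ← Set.ncard_image_of_injective {a | a ∈ L.shiftZero ∧ _}
      (add_left_injective (Finsupp.single 0 1)), image_cons_sliceZero,
    ← Set.ncard_union_eq ?_ ((finite_degree_eq L (n + 1)).subset fun _ h => h.1)
      ((finite_degree_eq _ _).image _)]
  · congr 1
    ext a
    constructor
    · rintro ⟨ha, hn⟩
      by_cases h0 : a 0 = 0
      · exact Or.inl ⟨⟨ha, hn⟩, h0⟩
      · have hle : Finsupp.single 0 1 ≤ a := by
          simpa [Nat.one_le_iff_ne_zero] using h0
        refine Or.inr ⟨a - Finsupp.single 0 1, ⟨?_, ?_⟩, tsub_add_cancel_of_le hle⟩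
        · change _ + _ ∈ L
          rwa [tsub_add_cancel_of_le hle]
        · rw [← tsub_add_cancel_of_le hle, map_add, Finsupp.degree_single] at hn
          omega
    · rintro (⟨h, -⟩ | ⟨b, ⟨hb, rfl⟩, rfl⟩)
      · exact h
      · exact ⟨hb, by simp⟩
  · rw [Set.disjoint_left]
    rintro a ⟨-, h0⟩ ⟨b, -, rfl⟩
    simp at h0

open PowerSeries in
/-- The generating series of the degrees of a lower set in `ℕʳ` is a polynomial divided
by `(1 - X) ^ r`. -/
theorem exists_polynomial_degreeCount_eq {r : ℕ} (L : LowerSet (Fin r →₀ ℕ)) :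
    ∃ p : Polynomial ℚ,
      (PowerSeries.mk fun n => (degreeCount L n : ℚ)) * (1 - X) ^ r = (p : ℚ⟦X⟧) := by
  induction r with
  | zero =>
    refine ⟨Polynomial.C (degreeCount L 0 : ℚ), ?_⟩
    ext n
    rcases n with _ | n
    · simp
    · have : degreeCount L (n + 1) = 0 := by
        unfold degreeCount
        convert! Set.ncard_empty (Fin 0 →₀ ℕ)
        ext a
        simp [Subsingleton.elim a 0]
      simp [this]
  | succ r ih =>
    induction L using WellFoundedLT.induction with
    | ind L IH =>
    have key : (PowerSeries.mk fun n => (degreeCount L n : ℚ)) =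
        (PowerSeries.mk fun n => (degreeCount L.sliceZero n : ℚ)) +
          X * PowerSeries.mk fun n => (degreeCount L.shiftZero n : ℚ) := by
      ext n
      rcases n with _ | n
      · simp [degreeCount_zero]
      · simp [degreeCount_succ]
    obtain ⟨p, hp⟩ := ih L.sliceZero
    rcases L.shiftZero_le.eq_or_lt with h | h
    · refine ⟨p, ?_⟩
      rw [h] at key
      rw [← hp, pow_succ]
      linear_combination (1 - X) ^ r * key
    · obtain ⟨q, hq⟩ := IH _ h
      refine ⟨p * (1 - Polynomial.X) + Polynomial.X * q, ?_⟩
      rw [key]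
      push_cast
      rw [← hp, ← hq]
      ring

theorem exists_polynomial_eval_eq_degreeCount {r : ℕ} (L : LowerSet (Fin r →₀ ℕ)) :
    ∃ P : Polynomial ℚ, ∀ᶠ n : ℕ in atTop, (degreeCount L n : ℚ) = P.eval (n : ℚ) := by
  obtain ⟨p, hp⟩ := exists_polynomial_degreeCount_eq L
  refine ⟨Polynomial.hilbertPoly p r, ?_⟩
  filter_upwards [eventually_gt_atTop p.natDegree] with n hn
  rw [← Polynomial.coeff_mul_invOneSubPow_eq_hilbertPoly_eval r hn, ← hp, mul_assoc,
    ← PowerSeries.invOneSubPow_inv_eq_one_sub_pow, Units.inv_val, mul_one, PowerSeries.coeff_mk]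

end Monomials

theorem finrank_span_insert_of_notMem {K W : Type*} [Field K] [AddCommGroup W] [Module K W]
    {S : Set W} (hS : S.Finite) {x : W} (hx : x ∉ Submodule.span K S) :
    finrank K (Submodule.span K (insert x S)) = finrank K (Submodule.span K S) + 1 := by
  have := FiniteDimensional.span_of_finite K hS
  have hx0 : x ≠ 0 := fun h => hx (h ▸ zero_mem _)
  have h := Submodule.finrank_sup_add_finrank_inf_eq (K ∙ x) (Submodule.span K S)
  have hd : (K ∙ x) ⊓ Submodule.span K S = ⊥ :=
    ((Submodule.disjoint_span_singleton' hx0).2 hx).symm.eq_bot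
  rw [hd, finrank_bot, finrank_span_singleton hx0] at h
  rw [Submodule.span_insert]
  omega

/-- The dimension of the span of a finite family counts the members which are not in the span of
the strictly smaller ones. -/
theorem finrank_span_image_eq_ncard {K W ι κ : Type*} [Field K] [AddCommGroup W] [Module K W]
    [LinearOrder κ] (u : ι → W) {f : ι → κ} (hf : Function.Injective f) (s : Finset ι) :
    finrank K (Submodule.span K (u '' s)) =
      {i | i ∈ s ∧ u i ∉ Submodule.span K (u '' {j | j ∈ s ∧ f j < f i})}.ncard := by
  classical
  induction s using Finset.induction_on_max_value f with
  | empty =>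
    rw [Finset.coe_empty, Set.image_empty, Submodule.span_empty, finrank_bot]
    simp
  | insert a s has hle ih =>
    have hlt : ∀ x ∈ s, f x < f a := fun x hx =>
      (hle x hx).lt_of_ne fun h => has (hf h ▸ hx)
    have hold : ∀ i ∈ s, {j | j ∈ insert a s ∧ f j < f i} = {j | j ∈ s ∧ f j < f i} := by
      intro i hi
      ext j
      simp only [Finset.mem_insert, Set.mem_ofPred_eq]
      refine ⟨?_, fun h => ⟨Or.inr h.1, h.2⟩⟩
      rintro ⟨rfl | h, h'⟩
      · exact absurd h' (hlt i hi).not_gt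
      · exact ⟨h, h'⟩
    have hnew : {j | j ∈ insert a s ∧ f j < f a} = (s : Set ι) := by
      ext j
      simp only [Finset.mem_insert, Set.mem_ofPred_eq, Finset.mem_coe]
      refine ⟨?_, fun h => ⟨Or.inr h, hlt j h⟩⟩
      rintro ⟨rfl | h, h'⟩
      · exact absurd h' (lt_irrefl _)
      · exact h
    rw [Finset.coe_insert, Set.image_insert_eq]
    by_cases ha : u a ∈ Submodule.span K (u '' s)
    · rw [Submodule.span_insert_eq_span ha, ih]
      congr 1
      ext i
      simp only [Set.mem_ofPred_eq]
      constructor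
      · rintro ⟨hi, h⟩
        exact ⟨Finset.mem_insert_of_mem hi, by rwa [hold i hi]⟩
      · rintro ⟨hi, h⟩
        rcases Finset.mem_insert.1 hi with rfl | hi
        · rw [hnew] at h
          exact absurd ha h
        · exact ⟨hi, by rwa [hold i hi] at h⟩
    · rw [finrank_span_insert_of_notMem (s.finite_toSet.image u) ha, ih,
        ← Set.ncard_insert_of_notMem (a := a) (fun h => has h.1)
          (s.finite_toSet.subset fun _ h => h.1)]
      congr 1
      ext i
      simp only [Set.mem_ofPred_eq, Set.mem_insert_iff]
      constructor
      · rintro (rfl | ⟨hi, h⟩)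
        · exact ⟨Finset.mem_insert_self _ _, by rwa [hnew]⟩
        · exact ⟨Finset.mem_insert_of_mem hi, by rwa [hold i hi]⟩
      · rintro ⟨hi, h⟩
        rcases Finset.mem_insert.1 hi with rfl | hi
        · exact Or.inl rfl
        · exact Or.inr ⟨hi, by rwa [hold i hi] at h⟩

section HilbertPolynomial

variable {K A : Type*} [Field K] [CommRing A] [Algebra K A]

/-- The exponents of the monomials in `v` that are not linear combinations of smaller monomials
of the same degree. -/
noncomputable def standardExponents (K : Type*) {A : Type*} [Field K] [CommRing A] [Algebra K A]
    {r : ℕ} (v : Fin r → A) : LowerSet (Fin r →₀ ℕ) where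
  carrier := {a | MvPolynomial.aeval v (MvPolynomial.monomial a (1 : K)) ∉
    Submodule.span K ((fun b => MvPolynomial.aeval v (MvPolynomial.monomial b (1 : K))) ''
      {b | b.degree = a.degree ∧ MonomialOrder.lex.toSyn b < MonomialOrder.lex.toSyn a})}
  lower' := by
    intro a b hba ha hb
    apply ha
    have hmul : ∀ c, MvPolynomial.aeval v (MvPolynomial.monomial (c + (a - b)) (1 : K)) =
        MvPolynomial.aeval v (MvPolynomial.monomial c (1 : K)) *
          MvPolynomial.aeval v (MvPolynomial.monomial (a - b) (1 : K)) := by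
      intro c
      rw [← map_mul, MvPolynomial.monomial_mul, one_mul]
    have hab : b + (a - b) = a := add_tsub_cancel_of_le hba
    have h := hmul b
    rw [hab] at h
    rw [h]
    generalize MvPolynomial.aeval v (MvPolynomial.monomial b (1 : K)) = x at hb
    induction hb using Submodule.span_induction with
    | mem x hx =>
      obtain ⟨c, ⟨hc, hlt⟩, rfl⟩ := hx
      refine Submodule.subset_span ⟨c + (a - b), ⟨?_, ?_⟩, hmul c⟩
      · rw [map_add, hc, ← map_add, hab]
      · conv_rhs => rw [← hab]
        rw [map_add, map_add]
        exact add_lt_add_left hlt _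
    | zero => simp
    | add x y _ _ hx hy => rw [add_mul]; exact add_mem hx hy
    | smul k x _ hx => rw [smul_mul_assoc]; exact Submodule.smul_mem _ _ hx

theorem span_range_pow_eq {r : ℕ} (v : Fin r → A) (n : ℕ) :
    (Submodule.span K (Set.range v)) ^ n =
      Submodule.span K ((fun b => MvPolynomial.aeval v (MvPolynomial.monomial b (1 : K))) ''
        {b | b.degree = n}) := by
  have h1 : Submodule.span K (Set.range v) =
      (MvPolynomial.homogeneousSubmodule (Fin r) K 1).map (MvPolynomial.aeval v).toLinearMap := by
    rw [MvPolynomial.homogeneousSubmodule_one_eq_span_X, Submodule.map_span, ← Set.range_comp]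
    congr 2
    ext i
    simp
  rw [h1, ← Submodule.map_pow, MvPolynomial.homogeneousSubmodule_one_pow,
    MvPolynomial.homogeneousSubmodule_eq_finsupp_supported,
    AddMonoidAlgebra.supported_eq_span_single, Submodule.map_span, Set.image_image]
  rfl

theorem finrank_span_range_pow_eq_degreeCount {r : ℕ} (v : Fin r → A) (n : ℕ) :
    finrank K ↥((Submodule.span K (Set.range v)) ^ n) =
      degreeCount (standardExponents K v) n := by
  have hfin : {b : Fin r →₀ ℕ | b.degree = n}.Finite :=
    (Finsupp.finite_of_degree_le n).subset fun _ h => h.le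
  have hcount := finrank_span_image_eq_ncard (K := K)
    (fun b => MvPolynomial.aeval v (MvPolynomial.monomial b (1 : K)))
    (MonomialOrder.lex (σ := Fin r)).toSyn.injective hfin.toFinset
  rw [hfin.coe_toFinset] at hcount
  rw [span_range_pow_eq, hcount, degreeCount]
  congr 1
  ext a
  simp only [Set.Finite.mem_toFinset, Set.mem_ofPred_eq]
  constructor
  · rintro ⟨rfl, h⟩
    exact ⟨h, rfl⟩
  · rintro ⟨h, rfl⟩
    exact ⟨rfl, h⟩

/-- Hilbert's theorem for algebras generated in degree one. -/
theorem exists_hilbertPolynomial {V : Submodule K A} (hV : V.FG) :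
    ∃ P : Polynomial ℚ, ∀ᶠ n : ℕ in atTop, (finrank K ↥(V ^ n) : ℚ) = P.eval (n : ℚ) := by
  obtain ⟨r, v, rfl⟩ := Submodule.fg_iff_exists_fin_generating_family.1 hV
  simp only [finrank_span_range_pow_eq_degreeCount]
  exact exists_polynomial_eval_eq_degreeCount _

end HilbertPolynomial

section GrowthRate

variable {K R : Type*} [Field K] [CommRing R] [Algebra K R]

theorem Submodule.exists_le_of_fg_of_monotone {E : ℕ → Submodule K R} (hE : Monotone E)
    {N : Submodule K R} (hN : N.FG) (h : ∀ x ∈ N, ∃ n, x ∈ E n) : ∃ n, N ≤ E n := by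
  obtain ⟨S, rfl⟩ := hN
  choose! n hn using fun x (hx : x ∈ S) => h x (Submodule.subset_span hx)
  refine ⟨S.sup n, Submodule.span_le.2 fun x hx => ?_⟩
  exact hE (Finset.le_sup hx) (hn x hx)

theorem Submodule.finrank_mul_le {M N : Submodule K R} (hM : M.FG) (hN : N.FG) :
    finrank K ↥(M * N) ≤ finrank K M * finrank K N := by
  have := Module.Finite.iff_fg.2 hM
  have := Module.Finite.iff_fg.2 hN
  rw [← Submodule.mulMap_range, ← Module.finrank_tensorProduct]
  exact LinearMap.finrank_range_le _

theorem finrank_restrictDegree (s n : ℕ) :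
    finrank K ↥(MvPolynomial.restrictDegree (Fin s) K n) = (n + 1) ^ s := by
  have e : {a : Fin s →₀ ℕ | ∀ i, a i ≤ n} ≃ (Fin s → Fin (n + 1)) :=
    { toFun := fun a i => ⟨a.1 i, Nat.lt_succ_of_le (a.2 i)⟩
      invFun := fun f => ⟨Finsupp.equivFunOnFinite.symm fun i => (f i : ℕ),
        fun i => Nat.le_of_lt_succ (f i).2⟩
      left_inv := fun a => by ext; rfl
      right_inv := fun f => by ext; rfl }
  rw [MvPolynomial.restrictDegree,
    Module.finrank_eq_nat_card_basis (MvPolynomial.basisRestrictSupport K _), Nat.card_congr e]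
  simp

theorem restrictDegree_add (s m n : ℕ) :
    MvPolynomial.restrictDegree (Fin s) K (m + n) =
      MvPolynomial.restrictDegree (Fin s) K m * MvPolynomial.restrictDegree (Fin s) K n := by
  simp only [MvPolynomial.restrictDegree]
  rw [← MvPolynomial.restrictSupport_add]
  congr 1
  ext a
  simp only [Set.mem_add, Set.mem_ofPred_eq]
  constructor
  · intro ha
    refine ⟨Finsupp.equivFunOnFinite.symm fun i => min (a i) m, fun i => min_le_right _ _,
      Finsupp.equivFunOnFinite.symm fun i => a i - m, fun i => ?_, ?_⟩
    · have := ha i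
      change a i - m ≤ n
      omega
    · ext i
      change min (a i) m + (a i - m) = a i
      omega
  · rintro ⟨b, hb, c, hc, rfl⟩ i
    exact add_le_add (hb i) (hc i)

theorem restrictDegree_eq_pow (s n : ℕ) :
    MvPolynomial.restrictDegree (Fin s) K n = MvPolynomial.restrictDegree (Fin s) K 1 ^ n := by
  induction n with
  | zero =>
    rw [pow_zero, ← MvPolynomial.restrictSupport_zero, MvPolynomial.restrictDegree]
    congr 1
    ext a
    simp [Finsupp.ext_iff]
  | succ n ih => rw [restrictDegree_add, ih, pow_succ]

theorem exists_mem_pow_of_adjoin_eq_top {W : Submodule K R} (h1 : 1 ≤ W)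
    (hadj : Algebra.adjoin K (W : Set R) = ⊤) (x : R) : ∃ n, x ∈ W ^ n := by
  have hmono : Monotone fun n => W ^ n := fun a b hab => pow_le_pow_right₀ h1 hab
  have hx : x ∈ Algebra.adjoin K (W : Set R) := hadj ▸ Algebra.mem_top
  induction hx using Algebra.adjoin_induction with
  | mem x hx => exact ⟨1, by simpa using hx⟩
  | algebraMap r => exact ⟨0, by rw [pow_zero]; exact Submodule.algebraMap_mem r⟩
  | add x y _ _ hx hy =>
    obtain ⟨a, ha⟩ := hx
    obtain ⟨b, hb⟩ := hy
    exact ⟨max a b, add_mem (hmono (le_max_left a b) ha) (hmono (le_max_right a b) hb)⟩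
  | mul x y _ _ hx hy =>
    obtain ⟨a, ha⟩ := hx
    obtain ⟨b, hb⟩ := hy
    exact ⟨a + b, by rw [pow_add]; exact Submodule.mul_mem_mul ha hb⟩

/-- The Krull dimension of a finitely generated algebra is its rate of growth. -/
theorem exists_ringKrullDim_eq_and_finrank_pow_bounds [Nontrivial R] {W : Submodule K R}
    (hW : W.FG) (h1 : 1 ≤ W) (hadj : Algebra.adjoin K (W : Set R) = ⊤) :
    ∃ s k c l : ℕ, ringKrullDim R = s ∧
      (∀ n, (n + 1) ^ s ≤ finrank K ↥(W ^ (k * n))) ∧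
      ∀ n, finrank K ↥(W ^ n) ≤ (l * n + l + 1) ^ s * c := by
  have hmonoW : Monotone fun n => W ^ n := fun a b hab => pow_le_pow_right₀ h1 hab
  have : Algebra.FiniteType K R := by
    obtain ⟨S, hS⟩ := hW
    exact ⟨S, by rw [← hadj, ← hS, Algebra.adjoin_span]⟩
  obtain ⟨s, g, hinj, hfin⟩ := exists_finite_inj_algHom_of_fg K R
  let _ : Algebra (MvPolynomial (Fin s) K) R := g.toRingHom.toAlgebra
  have hmod : Module.Finite (MvPolynomial (Fin s) K) R := hfin
  have hfaith : FaithfulSMul (MvPolynomial (Fin s) K) R :=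
    (faithfulSMul_iff_algebraMap_injective _ _).2 hinj
  have hdim : ringKrullDim R = s := by
    rw [ringKrullDim_eq_of_isIntegral (R := MvPolynomial (Fin s) K)]
    simp [ringKrullDim_eq_zero_of_field]
  let D : ℕ → Submodule K R := fun n =>
    (MvPolynomial.restrictDegree (Fin s) K n).map g.toLinearMap
  have hDadd : ∀ m n, D (m + n) = D m * D n := fun m n => by
    simp only [D, restrictDegree_add, Submodule.map_mul]
  have hDpow : ∀ n, D n = D 1 ^ n := fun n => by
    simp only [D]
    rw [restrictDegree_eq_pow, Submodule.map_pow]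
  have hDfin : ∀ n, (D n).FG := fun n => (Module.Finite.iff_fg.1 inferInstance).map _
  have hDrank : ∀ n, finrank K (D n) = (n + 1) ^ s := fun n => by
    rw [← finrank_restrictDegree (K := K) s n]
    exact (Submodule.equivMapOfInjective g.toLinearMap hinj _).finrank_eq.symm
  have hD1 : 1 ≤ D 1 := by
    rw [Submodule.one_le]
    refine ⟨1, ?_, map_one g⟩
    have : (1 : Submodule K (MvPolynomial (Fin s) K)) ≤ MvPolynomial.restrictDegree (Fin s) K 1 := by
      rw [← MvPolynomial.restrictSupport_zero]
      refine MvPolynomial.restrictSupport_mono _ ?_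
      rintro a rfl i
      simp
    exact Submodule.one_le.1 this
  have hDmono : Monotone D := fun a b hab => by
    rw [hDpow a, hDpow b]
    exact pow_le_pow_right₀ hD1 hab
  have hDex : ∀ p, ∃ n, g p ∈ D n := fun p => by
    refine ⟨p.totalDegree, p, ?_, rfl⟩
    exact MvPolynomial.restrictTotalDegree_le_restrictDegree _ _ _
      ((MvPolynomial.mem_restrictTotalDegree _ _ _).2 le_rfl)
  obtain ⟨k, hk⟩ := Submodule.exists_le_of_fg_of_monotone hmonoW (hDfin 1)
    fun x _ => exists_mem_pow_of_adjoin_eq_top h1 hadj x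
  obtain ⟨S, hS⟩ := hmod.fg_top
  let M : Submodule K R := Submodule.span K S
  have hMfg : M.FG := ⟨S, rfl⟩
  have hEmono : Monotone fun n => D n * M := fun a b hab => mul_le_mul_left (hDmono hab) M
  have hEex : ∀ x, ∃ n, x ∈ D n * M := fun x => by
    have hx : x ∈ Submodule.span (MvPolynomial (Fin s) K) (S : Set R) := hS ▸ Submodule.mem_top
    induction hx using Submodule.span_induction with
    | mem x hx =>
      exact ⟨1, one_mul x ▸ Submodule.mul_mem_mul (Submodule.one_le.1 hD1)
        (Submodule.subset_span hx)⟩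
    | zero => exact ⟨0, zero_mem _⟩
    | add x y _ _ hx hy =>
      obtain ⟨a, ha⟩ := hx
      obtain ⟨b, hb⟩ := hy
      exact ⟨max a b, add_mem (hEmono (le_max_left a b) ha) (hEmono (le_max_right a b) hb)⟩
    | smul p x _ hx =>
      obtain ⟨a, ha⟩ := hx
      obtain ⟨b, hb⟩ := hDex p
      refine ⟨b + a, ?_⟩
      rw [hDadd, mul_assoc]
      exact Submodule.mul_mem_mul hb ha
  obtain ⟨i, hi⟩ := Submodule.exists_le_of_fg_of_monotone hEmono (hW.mul hMfg)
    fun x _ => hEex x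
  obtain ⟨j, hj⟩ := hEex 1
  have hWM : ∀ n, W ^ n * M ≤ D (i * n) * M := fun n => by
    induction n with
    | zero =>
      rw [pow_zero, Nat.mul_zero, hDpow, pow_zero]
    | succ n ih =>
      calc W ^ (n + 1) * M = W * (W ^ n * M) := by rw [pow_succ', mul_assoc]
        _ ≤ W * (D (i * n) * M) := mul_le_mul_right ih W
        _ = D (i * n) * (W * M) := by ring
        _ ≤ D (i * n) * (D i * M) := mul_le_mul_right hi _
        _ = D (i * (n + 1)) * M := by rw [← mul_assoc, ← hDadd, Nat.mul_succ]
  have hWle : ∀ n, W ^ n ≤ D (max i j * n + max i j) * M := fun n => by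
    calc W ^ n = W ^ n * 1 := (mul_one _).symm
      _ ≤ W ^ n * (D j * M) := mul_le_mul_right (Submodule.one_le.2 hj) _
      _ = D j * (W ^ n * M) := by ring
      _ ≤ D j * (D (i * n) * M) := mul_le_mul_right (hWM n) _
      _ = D (j + i * n) * M := by rw [← mul_assoc, hDadd]
      _ ≤ _ := hEmono (by
          have := Nat.mul_le_mul_right n (le_max_left i j)
          have := le_max_right i j
          omega)
  refine ⟨s, k, finrank K M, max i j, hdim, fun n => ?_, fun n => ?_⟩
  · have := Module.Finite.iff_fg.2 ((hW.pow k).pow n)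
    rw [← hDrank, hDpow, pow_mul]
    exact Submodule.finrank_mono (pow_le_pow_left₀ bot_le hk n)
  · have := Module.Finite.iff_fg.2 ((hDfin (max i j * n + max i j)).mul hMfg)
    rw [← hDrank]
    exact (Submodule.finrank_mono (hWle n)).trans
      (Submodule.finrank_mul_le (hDfin _) hMfg)

end GrowthRate

section GradedDomain

variable {K A : Type*} [Field K] [CommRing A] [Algebra K A]

theorem Submodule.finrank_le_of_forall_mul_mem [IsDomain A] {M N : Submodule K A} (hN : N.FG)
    {v : A} (hv : v ≠ 0) (h : ∀ x ∈ M, v * x ∈ N) : finrank K M ≤ finrank K N := by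
  have := Module.Finite.iff_fg.2 hN
  refine LinearMap.finrank_le_finrank_of_injective (f := (LinearMap.mulLeft K v).restrict h) ?_
  intro x y hxy
  exact Subtype.ext (mul_left_cancel₀ hv (congrArg Subtype.val hxy))

theorem Submodule.one_sup_pow (V : Submodule K A) (n : ℕ) :
    (1 ⊔ V) ^ n = (Finset.range (n + 1)).sup fun i => V ^ i := by
  induction n with
  | zero => simp
  | succ n ih =>
    rw [pow_succ', ih]
    apply le_antisymm
    · rw [Submodule.sup_mul, one_mul]
      refine sup_le (Finset.sup_mono (Finset.range_mono (Nat.le_succ _))) ?_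
      rw [Finset.sup_eq_iSup, Submodule.mul_iSup]
      refine iSup_le fun i => ?_
      rw [Submodule.mul_iSup]
      refine iSup_le fun hi => ?_
      rw [← pow_succ']
      exact Finset.le_sup (f := fun i => V ^ i)
        (Finset.mem_range.2 (Nat.succ_lt_succ (Finset.mem_range.1 hi)))
    · refine Finset.sup_le fun i hi => ?_
      rcases i with _ | i
      · rw [pow_zero]
        calc (1 : Submodule K A) = 1 * V ^ 0 := by simp
          _ ≤ _ := mul_le_mul' le_sup_left
            (Finset.le_sup (f := fun i => V ^ i) (Finset.mem_range.2 (Nat.succ_pos _)))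
      · rw [pow_succ']
        exact mul_le_mul' le_sup_right (Finset.le_sup (f := fun i => V ^ i)
          (Finset.mem_range.2 (Nat.lt_of_succ_lt_succ (Finset.mem_range.1 hi))))

theorem finrank_sup_range_of_iSupIndep {W : ℕ → Submodule K A} (hW : iSupIndep W)
    (hfg : ∀ n, (W n).FG) (n : ℕ) :
    finrank K ↥((Finset.range n).sup W) = ∑ i ∈ Finset.range n, finrank K (W i) := by
  induction n with
  | zero => rw [Finset.range_zero, Finset.sup_empty, finrank_bot, Finset.sum_empty]
  | succ n ih =>
    have hfin : ((Finset.range n).sup W).FG := Submodule.fg_finset_sup _ _ fun i _ => hfg i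
    have := Module.Finite.iff_fg.2 hfin
    have := Module.Finite.iff_fg.2 (hfg n)
    have hd : Disjoint (W n) ((Finset.range n).sup W) := by
      rw [Finset.sup_eq_iSup]
      exact hW.disjoint_biSup (y := (Finset.range n : Set ℕ)) (by simp)
    have h := Submodule.finrank_sup_add_finrank_inf_eq (W n) ((Finset.range n).sup W)
    rw [hd.eq_bot, finrank_bot] at h
    rw [Finset.range_add_one, Finset.sup_insert, Finset.sum_insert (by simp), ← ih]
    exact h

variable (𝒜 : ℕ → Submodule K A) [GradedAlgebra 𝒜]

theorem pow_le_graded {V : Submodule K A} {p : ℕ} (hV : V ≤ 𝒜 p) (n : ℕ) :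
    V ^ n ≤ 𝒜 (n * p) := by
  induction n with
  | zero =>
    rw [pow_zero, Nat.zero_mul, Submodule.one_le]
    exact SetLike.GradedOne.one_mem
  | succ n ih =>
    rw [pow_succ, Nat.succ_mul, Submodule.mul_le]
    exact fun x hx y hy => SetLike.GradedMul.mul_mem (ih hx) (hV hy)

theorem iSupIndep_pow_of_le_graded {V : Submodule K A} {p : ℕ} (hp : 0 < p) (hV : V ≤ 𝒜 p) :
    iSupIndep fun n => V ^ n := by
  have h := (DirectSum.Decomposition.isInternal 𝒜).submodule_iSupIndep.comp
    (mul_left_injective₀ hp.ne')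
  exact h.mono fun n => pow_le_graded 𝒜 hV n

theorem le_of_eventually_pow_le {a b : ℕ} {C : ℝ}
    (h : ∀ᶠ n : ℕ in atTop, (n : ℝ) ^ a ≤ C * (n : ℝ) ^ b) : a ≤ b := by
  by_contra! hab
  obtain ⟨n, h, hn, hC⟩ := (h.and ((eventually_ge_atTop 1).and
    (tendsto_natCast_atTop_atTop.eventually_gt_atTop C))).exists
  have h1 : (1 : ℝ) ≤ n := by exact_mod_cast hn
  have h2 : (n : ℝ) ^ (b + 1) ≤ (n : ℝ) ^ a := pow_le_pow_right₀ h1 hab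
  have h3 : 0 < (n : ℝ) ^ b := by positivity
  rw [pow_succ] at h2
  nlinarith

theorem finrank_one_sup_pow {V : Submodule K A} {p : ℕ} (hp : 0 < p) (hV : V ≤ 𝒜 p) (hfg : V.FG)
    (n : ℕ) :
    finrank K ↥((1 ⊔ V) ^ n) = ∑ i ∈ Finset.range (n + 1), finrank K ↥(V ^ i) := by
  rw [Submodule.one_sup_pow]
  exact finrank_sup_range_of_iSupIndep (iSupIndep_pow_of_le_graded 𝒜 hp hV)
    (fun i => hfg.pow i) _

theorem finrank_pow_mono [IsDomain A] {V : Submodule K A} (hfg : V.FG) (hne : V ≠ ⊥) :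
    Monotone fun n => finrank K ↥(V ^ n) := by
  obtain ⟨v, hv, hv0⟩ := Submodule.exists_mem_ne_zero_of_ne_bot hne
  refine monotone_nat_of_le_succ fun n => ?_
  refine Submodule.finrank_le_of_forall_mul_mem (hfg.pow _) hv0 fun x hx => ?_
  rw [pow_succ']
  exact Submodule.mul_mem_mul hv hx

theorem exists_ringKrullDim_adjoin_eq_and_bounds (K : Type*) {A : Type*} [Field K] [CommRing A]
    [Algebra K A] [Nontrivial A] {V : Submodule K A} (hfg : V.FG) :
    ∃ s k c l : ℕ, ringKrullDim ↥(Algebra.adjoin K (V : Set A)) = s ∧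
      (∀ n, (n + 1) ^ s ≤ finrank K ↥((1 ⊔ V) ^ (k * n))) ∧
      ∀ n, finrank K ↥((1 ⊔ V) ^ n) ≤ (l * n + l + 1) ^ s * c := by
  let R := Algebra.adjoin K (V : Set A)
  let W : Submodule K R := (1 ⊔ V).comap R.val.toLinearMap
  have hinj : Function.Injective R.val.toLinearMap := Subtype.val_injective
  have hmap : W.map R.val.toLinearMap = 1 ⊔ V := by
    rw [Submodule.map_comap_eq, inf_eq_right]
    refine sup_le (Submodule.one_le.2 ⟨1, rfl⟩) fun x hx => ?_
    exact ⟨⟨x, Algebra.subset_adjoin hx⟩, rfl⟩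
  have hrank : ∀ n, finrank K ↥(W ^ n) = finrank K ↥((1 ⊔ V) ^ n) := fun n => by
    rw [← hmap, ← Submodule.map_pow]
    exact (Submodule.equivMapOfInjective _ hinj _).finrank_eq
  have hWfg : W.FG := by
    refine Submodule.fg_of_fg_map_injective _ hinj ?_
    rw [hmap]
    exact Submodule.FG.sup (by simpa using hfg.pow 0) hfg
  have hadj : Algebra.adjoin K (W : Set R) = ⊤ := by
    rw [eq_top_iff, ← Algebra.adjoin_adjoin_coe_preimage (s := (V : Set A))]
    exact Algebra.adjoin_mono fun x hx =>
      show (x : A) ∈ 1 ⊔ V from Submodule.mem_sup_right hx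
  have h1 : 1 ≤ W := Submodule.one_le.2 (Submodule.mem_sup_left (Submodule.one_le.1 le_rfl))
  obtain ⟨s, k, c, l, h⟩ := exists_ringKrullDim_eq_and_finrank_pow_bounds hWfg h1 hadj
  simp only [hrank] at h
  exact ⟨s, k, c, l, h⟩

theorem exists_tendsto_finrank_pow_div [IsDomain A] {V : Submodule K A} (hfg : V.FG)
    (hne : V ≠ ⊥) :
    ∃ (d : ℕ) (c : ℝ), 0 < c ∧
      Tendsto (fun n : ℕ => (finrank K ↥(V ^ n) : ℝ) / (n : ℝ) ^ d) atTop (nhds c) := by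
  obtain ⟨P, hP⟩ := exists_hilbertPolynomial hfg
  let Q : Polynomial ℝ := P.map (algebraMap ℚ ℝ)
  have hQ : ∀ᶠ n : ℕ in atTop, (finrank K ↥(V ^ n) : ℝ) = Q.eval (n : ℝ) := by
    filter_upwards [hP] with n hn
    have := congrArg (algebraMap ℚ ℝ) hn
    simpa [Q, Polynomial.eval_map_algebraMap, Polynomial.aeval_def, Polynomial.eval₂_at_natCast]
      using this
  have hpos : ∀ n, 1 ≤ finrank K ↥(V ^ n) := fun n => by
    have h := finrank_pow_mono hfg hne (Nat.zero_le n)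
    have := Module.Finite.iff_fg.2 (hfg.pow 0)
    exact le_trans (Submodule.one_le_finrank_iff.2 ((Submodule.ne_bot_iff _).2
      ⟨1, Submodule.one_le.1 (pow_zero V).ge, one_ne_zero⟩)) h
  have hQ0 : Q ≠ 0 := by
    intro h0
    obtain ⟨n, hn⟩ := hQ.exists
    have := hpos n
    rw [h0, Polynomial.eval_zero, Nat.cast_eq_zero] at hn
    omega
  have hlim : Tendsto (fun n : ℕ => (finrank K ↥(V ^ n) : ℝ) / (n : ℝ) ^ Q.natDegree) atTop
      (nhds Q.leadingCoeff) := by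
    have h := (Polynomial.div_tendsto_atTop_leadingCoeff_div_of_degree_eq Q
      (Polynomial.X ^ Q.natDegree) (by
        rw [Polynomial.degree_X_pow, Polynomial.degree_eq_natDegree hQ0])).comp
      (tendsto_natCast_atTop_atTop (R := ℝ))
    simp only [Polynomial.leadingCoeff_X_pow, div_one] at h
    refine h.congr' ?_
    filter_upwards [hQ] with n hn
    simp [hn]
  refine ⟨Q.natDegree, Q.leadingCoeff, lt_of_le_of_ne ?_ ?_, hlim⟩
  · exact ge_of_tendsto' hlim fun n => by positivity
  · exact (Polynomial.leadingCoeff_ne_zero.2 hQ0).symm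

theorem eventually_bounds_of_tendsto_div_pow {H : ℕ → ℕ} {d : ℕ} {c : ℝ} (hc : 0 < c)
    (h : Tendsto (fun n : ℕ => (H n : ℝ) / (n : ℝ) ^ d) atTop (nhds c)) :
    ∀ᶠ n : ℕ in atTop, c / 2 * (n : ℝ) ^ d ≤ H n ∧ (H n : ℝ) ≤ 2 * c * (n : ℝ) ^ d := by
  filter_upwards [h.eventually_const_le (half_lt_self hc),
    h.eventually_le_const (lt_two_mul_self hc), eventually_gt_atTop 0] with n h1 h2 hn
  have : 0 < (n : ℝ) ^ d := by positivity
  exact ⟨(le_div_iff₀ this).1 h1, (div_le_iff₀ this).1 h2⟩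

theorem exists_ringKrullDim_adjoin_eq_and_tendsto [IsDomain A] {V : Submodule K A} {p : ℕ}
    (hp : 0 < p) (hV : V ≤ 𝒜 p) (hfg : V.FG) (hne : V ≠ ⊥) :
    ∃ (d : ℕ) (c : ℝ), 0 < c ∧
      ringKrullDim ↥(Algebra.adjoin K (V : Set A)) = ((d + 1 : ℕ) : WithBot (WithTop ℕ)) ∧
      Tendsto (fun n : ℕ => (finrank K ↥(V ^ n) : ℝ) / (n : ℝ) ^ d) atTop (nhds c) := by
  obtain ⟨d, c, hc, hlim⟩ := exists_tendsto_finrank_pow_div hfg hne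
  obtain ⟨s, k, c', l, hdim, hlow, hup⟩ := exists_ringKrullDim_adjoin_eq_and_bounds K hfg
  have hmono := finrank_pow_mono hfg hne
  have hbd := eventually_bounds_of_tendsto_div_pow hc hlim
  have hsum := finrank_one_sup_pow 𝒜 hp hV hfg
  have hsd : s ≤ d + 1 := by
    have hmul : Tendsto (fun n : ℕ => (k + 1) * n) atTop atTop :=
      tendsto_id.const_mul_atTop' k.succ_pos
    refine le_of_eventually_pow_le (C := (k + 2) * (2 * c * (k + 1) ^ d)) ?_
    filter_upwards [hmul.eventually hbd, eventually_ge_atTop 1] with n hn hn1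
    have h1 : (n + 1) ^ s ≤ ((k + 1) * n + 1) * finrank K ↥(V ^ ((k + 1) * n)) := by
      refine (hlow n).trans ?_
      rw [hsum]
      refine (Finset.sum_le_card_nsmul _ _ (finrank K ↥(V ^ ((k + 1) * n))) ?_).trans ?_
      · intro i hi
        refine hmono ?_
        rw [Finset.mem_range] at hi
        nlinarith
      · rw [Finset.card_range, smul_eq_mul]
        exact Nat.mul_le_mul_right _ (by nlinarith)
    have h2 : ((n : ℝ) + 1) ^ s ≤ (((k : ℝ) + 1) * n + 1) * finrank K ↥(V ^ ((k + 1) * n)) := by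
      exact_mod_cast h1
    have hn1' : (1 : ℝ) ≤ n := by exact_mod_cast hn1
    have h3 := hn.2
    push_cast at h3
    calc (n : ℝ) ^ s ≤ ((n : ℝ) + 1) ^ s := by gcongr; linarith
      _ ≤ _ := h2
      _ ≤ ((k + 2) * n) * (2 * c * (((k : ℝ) + 1) * n) ^ d) := by
        gcongr
        nlinarith
      _ = _ := by rw [mul_pow]; ring
  have hds : d + 1 ≤ s := by
    refine le_of_eventually_pow_le (C := (2 / c) * ((3 * l + 1) ^ s * c')) ?_
    filter_upwards [hbd, eventually_ge_atTop 1] with n hn hn1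
    have h1 : n * finrank K ↥(V ^ n) ≤ (l * (2 * n) + l + 1) ^ s * c' := by
      refine le_trans ?_ (hup (2 * n))
      rw [hsum]
      have hsub : Finset.Ico n (2 * n) ⊆ Finset.range (2 * n + 1) := by
        intro i hi
        rw [Finset.mem_Ico] at hi
        rw [Finset.mem_range]
        omega
      refine le_trans ?_ (Finset.sum_le_sum_of_subset hsub)
      have h := Finset.card_nsmul_le_sum (Finset.Ico n (2 * n)) (fun i => finrank K ↥(V ^ i))
        (finrank K ↥(V ^ n)) fun i hi => hmono (Finset.mem_Ico.1 hi).1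
      rwa [Nat.card_Ico, two_mul, Nat.add_sub_cancel, smul_eq_mul, ← two_mul] at h
    have h2 : (n : ℝ) * finrank K ↥(V ^ n) ≤ ((l : ℝ) * (2 * n) + l + 1) ^ s * c' := by
      exact_mod_cast h1
    have hn1' : (1 : ℝ) ≤ n := by exact_mod_cast hn1
    have hl : (0 : ℝ) ≤ l := Nat.cast_nonneg l
    calc (n : ℝ) ^ (d + 1) = 2 / c * (n * (c / 2 * (n : ℝ) ^ d)) := by field_simp; ring
      _ ≤ 2 / c * (n * finrank K ↥(V ^ n)) := by gcongr; exact hn.1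
      _ ≤ 2 / c * (((l : ℝ) * (2 * n) + l + 1) ^ s * c') := by gcongr
      _ ≤ 2 / c * (((3 * l + 1) * n) ^ s * c') := by
        gcongr
        nlinarith
      _ = _ := by rw [mul_pow]; ring
  obtain rfl := le_antisymm hsd hds
  exact ⟨d, c, hc, hdim, hlim⟩

end GradedDomain

section Limits

theorem tendsto_comp_div_pow {H : ℕ → ℕ} {d : ℕ} {c : ℝ}
    (hH : Tendsto (fun n : ℕ => (H n : ℝ) / (n : ℝ) ^ d) atTop (nhds c)) {p : ℕ} (hp : 0 < p)
    {m : ℕ → ℕ} {C : ℝ} (hm : ∀ᶠ n in atTop, |(m n : ℝ) * p - n| ≤ C) :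
    Tendsto (fun n : ℕ => (H (m n) : ℝ) / (n : ℝ) ^ d) atTop (nhds (c / (p : ℝ) ^ d)) := by
  have hp' : (0 : ℝ) < p := Nat.cast_pos.2 hp
  have hC : Tendsto (fun n : ℕ => C / (n : ℝ)) atTop (nhds 0) :=
    tendsto_const_div_atTop_nhds_zero_nat C
  have hratio : Tendsto (fun n : ℕ => (m n : ℝ) / n) atTop (nhds (1 / p)) := by
    have h0 : Tendsto (fun n : ℕ => (m n : ℝ) * p / n - 1) atTop (nhds 0) := by
      refine squeeze_zero_norm' ?_ hC
      filter_upwards [hm, eventually_gt_atTop 0] with n hn hn0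
      have hn0' : (0 : ℝ) < n := Nat.cast_pos.2 hn0
      rw [Real.norm_eq_abs, div_sub_one hn0'.ne', abs_div, abs_of_pos hn0']
      gcongr
    have h1 := (h0.add_const 1).div_const (p : ℝ)
    rw [zero_add] at h1
    refine h1.congr fun n => ?_
    field_simp
    ring
  have hmtop : Tendsto m atTop atTop := by
    rw [← tendsto_natCast_atTop_iff (R := ℝ)]
    have h := (tendsto_atTop_add_const_right atTop (-C)
      (tendsto_natCast_atTop_atTop (R := ℝ))).atTop_div_const hp'
    refine tendsto_atTop_mono' _ ?_ h
    filter_upwards [hm] with n hn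
    rw [div_le_iff₀ hp']
    linarith [(abs_le.1 hn).1]
  have h := (hH.comp hmtop).mul (hratio.pow d)
  rw [one_div_pow, mul_one_div] at h
  refine h.congr' ?_
  filter_upwards [hmtop.eventually_gt_atTop 0] with n hn
  have hn' : (m n : ℝ) ≠ 0 := Nat.cast_ne_zero.2 hn.ne'
  simp only [Function.comp_apply, div_pow]
  field_simp

theorem exists_tendsto_of_forall_eventually_approx {x : ℕ → ℝ}
    (h : ∀ ε : ℝ, 0 < ε → ε < 1 → ∃ γ : ℝ, ∀ η : ℝ, 0 < η →
      ∀ᶠ n in atTop, γ - η ≤ x n ∧ (1 - ε) * x n ≤ γ + η) :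
    ∃ ℓ : ℝ, Tendsto x atTop (nhds ℓ) := by
  obtain ⟨γ₀, h₀⟩ := h (1 / 2) (by norm_num) (by norm_num)
  obtain ⟨M, hM0, hM⟩ : ∃ M : ℝ, 0 < M ∧ ∀ᶠ n in atTop, x n ≤ M := by
    refine ⟨max (2 * (γ₀ + 1)) 1, by positivity, ?_⟩
    filter_upwards [h₀ 1 one_pos] with n hn
    exact le_max_of_le_left (by linarith [hn.2])
  refine cauchySeq_tendsto_of_complete (Metric.cauchySeq_iff.2 fun δ hδ => ?_)
  have hε : 0 < min (1 / 2) (δ / (4 * M)) := by positivity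
  obtain ⟨γ, hγ⟩ := h (min (1 / 2) (δ / (4 * M))) hε
    ((min_le_left _ _).trans_lt (by norm_num))
  have hεM : min (1 / 2) (δ / (4 * M)) * M ≤ δ / 4 := by
    calc _ ≤ δ / (4 * M) * M := by gcongr; exact min_le_right _ _
      _ = δ / 4 := by field_simp
  generalize min (1 / 2) (δ / (4 * M)) = ε at hε hγ hεM
  obtain ⟨N, hN⟩ := eventually_atTop.1 ((hγ (δ / 8) (by positivity)).and hM)
  have hle : ∀ m ≥ N, ∀ n ≥ N, x m - x n < δ := fun m hm n hn => by
    have h1 := (hN m hm).1.2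
    have h2 := mul_le_mul_of_nonneg_left (hN m hm).2 hε.le
    have h3 := (hN n hn).1.1
    linarith
  refine ⟨N, fun m hm n hn => ?_⟩
  rw [Real.dist_eq, abs_lt]
  constructor <;> linarith [hle m hm n hn, hle n hn m hm]

end Limits

theorem finrank_graded_le_add {K A : Type*} [Field K] [CommRing A] [IsDomain A] [Algebra K A]
    (𝒜 : ℕ → Submodule K A) [GradedAlgebra 𝒜] (hfin : ∀ n, FiniteDimensional K ↥(𝒜 n))
    (n : ℕ) {k : ℕ} (hk : 𝒜 k ≠ ⊥) : finrank K ↥(𝒜 n) ≤ finrank K ↥(𝒜 (n + k)) := by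
  obtain ⟨v, hv, hv0⟩ := Submodule.exists_mem_ne_zero_of_ne_bot hk
  refine Submodule.finrank_le_of_forall_mul_mem (Module.Finite.iff_fg.1 (hfin _)) hv0 fun x hx => ?_
  rw [mul_comm]
  exact SetLike.GradedMul.mul_mem hx hv

/-- Let `B = ⊕ₙ Bₙ` (here the graded pieces `𝒜 n` of a graded
domain `A`) be an integral graded `K`-algebra which is approximable. Then there
is `a ∈ ℕ \ {0}` such that for all sufficiently large `p`, the subalgebra
`⊕ₙ Im(Sⁿ B_p → B_{np})` (i.e. the `K`-subalgebra generated by `B_p`) has Krull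
dimension `a`; moreover, with `d(B) = a - 1`, the sequence
`rank B_n · d(B)! / n^{d(B)}` converges in `ℝ₊`.

The image of `Sⁿ B_p → B_{np}` is the submodule power `(𝒜 p) ^ n`. -/
theorem stmt3 {K A : Type*} [Field K] [CommRing A] [IsDomain A] [Algebra K A]
    (𝒜 : ℕ → Submodule K A) [GradedAlgebra 𝒜]
    (hfin : ∀ n, FiniteDimensional K ↥(𝒜 n))
    (hne : ∃ N : ℕ, ∀ n ≥ N, 𝒜 n ≠ ⊥)
    (happr : ∀ ε : ℝ, 0 < ε → ε < 1 → ∃ p₀ : ℕ, 1 ≤ p₀ ∧ ∀ p ≥ p₀,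
      (1 - ε) < Filter.liminf
        (fun n : ℕ => (finrank K ↥((𝒜 p) ^ n) : ℝ) / (finrank K ↥(𝒜 (n * p)) : ℝ))
        Filter.atTop) :
    ∃ a : ℕ, 0 < a ∧
      (∃ p₁ : ℕ, ∀ p ≥ p₁,
        ringKrullDim ↥(Algebra.adjoin K ((𝒜 p : Set A))) = (a : WithBot (WithTop ℕ))) ∧
      (∃ ℓ : ℝ, 0 ≤ ℓ ∧ Filter.Tendsto
        (fun n : ℕ => (finrank K ↥(𝒜 n) : ℝ) * (Nat.factorial (a - 1) : ℝ) / (n : ℝ) ^ (a - 1))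
        Filter.atTop (nhds ℓ)) := by
  obtain ⟨N, hN⟩ := hne
  have hfg : ∀ n, (𝒜 n).FG := fun n => Module.Finite.iff_fg.1 (hfin n)
  have hle : ∀ p n, finrank K ↥(𝒜 p ^ n) ≤ finrank K ↥(𝒜 (n * p)) := fun p n =>
    Submodule.finrank_mono (pow_le_graded 𝒜 le_rfl n)
  have happr' : ∀ ε : ℝ, 0 < ε → ε < 1 → ∃ p₀ : ℕ, 1 ≤ p₀ ∧ ∀ p ≥ p₀, ∀ᶠ n : ℕ in atTop,
      (1 - ε) * (finrank K ↥(𝒜 (n * p)) : ℝ) ≤ finrank K ↥(𝒜 p ^ n) := by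
    intro ε h0 h1
    obtain ⟨p₀, hp₀, h⟩ := happr ε h0 h1
    refine ⟨p₀, hp₀, fun p hp => ?_⟩
    filter_upwards [eventually_lt_of_lt_liminf (h p hp)
      (isBoundedUnder_of ⟨0, fun n => by positivity⟩)] with n hn
    rcases (Nat.cast_nonneg (α := ℝ) (finrank K ↥(𝒜 (n * p)))).eq_or_lt with h0 | h0
    · rw [← h0, mul_zero]
      positivity
    · exact ((lt_div_iff₀ h0).1 hn).le
  obtain ⟨q, hq, hhalf⟩ := happr' (1 / 2) (by norm_num) (by norm_num)
  have hpos : ∀ p ≥ max N q, 0 < p := fun p hp => hq.trans ((le_max_right _ _).trans hp)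
  have hpN : ∀ p ≥ max N q, 𝒜 p ≠ ⊥ := fun p hp => hN p ((le_max_left _ _).trans hp)
  have hex := fun p (hp : p ≥ max N q) =>
    exists_ringKrullDim_adjoin_eq_and_tendsto 𝒜 (hpos p hp) le_rfl (hfg p) (hpN p hp)
  choose! d c hc hdim hlim using hex
  have hdle : ∀ p ≥ max N q, ∀ p' ≥ max N q, d p' ≤ d p := by
    intro p hp p' hp'
    have hmul : Tendsto (fun n : ℕ => n * p) atTop atTop := tendsto_id.atTop_mul_const' (hpos p hp)
    have hmul' : Tendsto (fun n : ℕ => n * p') atTop atTop :=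
      tendsto_id.atTop_mul_const' (hpos p' hp')
    have hp0 : (1 : ℝ) ≤ p := by exact_mod_cast hpos p hp
    have hc' := hc p' hp'
    refine le_of_eventually_pow_le
      (C := 2 / c p' * (2 * (2 * c p * (p' : ℝ) ^ d p))) ?_
    filter_upwards [hmul.eventually (eventually_bounds_of_tendsto_div_pow (hc p' hp') (hlim p' hp')),
      hmul'.eventually (eventually_bounds_of_tendsto_div_pow (hc p hp) (hlim p hp)),
      hmul'.eventually (hhalf p ((le_max_right _ _).trans hp))] with n h1 h2 h3
    have h4 : (finrank K ↥(𝒜 p' ^ (n * p)) : ℝ) ≤ finrank K ↥(𝒜 (n * p' * p)) := by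
      rw [mul_right_comm]
      exact_mod_cast hle p' (n * p)
    have h5 : c p' / 2 * (n : ℝ) ^ d p' ≤ 2 * (2 * c p * (p' : ℝ) ^ d p * (n : ℝ) ^ d p) := by
      calc c p' / 2 * (n : ℝ) ^ d p' ≤ c p' / 2 * ((n * p : ℕ) : ℝ) ^ d p' := by
            push_cast
            gcongr
            exact le_mul_of_one_le_right (Nat.cast_nonneg n) hp0
        _ ≤ 2 * (2 * c p * ((n * p' : ℕ) : ℝ) ^ d p) := by linarith [h1.1, h2.2]
        _ = _ := by
            push_cast
            rw [mul_pow]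
            ring
    calc (n : ℝ) ^ d p' = 2 / c p' * (c p' / 2 * (n : ℝ) ^ d p') := by field_simp
      _ ≤ 2 / c p' * (2 * (2 * c p * (p' : ℝ) ^ d p * (n : ℝ) ^ d p)) := by gcongr
      _ = _ := by ring
  have hd : ∀ p ≥ max N q, d p = d (max N q) := fun p hp =>
    le_antisymm (hdle _ le_rfl p hp) (hdle p hp _ le_rfl)
  generalize d (max N q) = e at hd
  have hconv : ∃ ℓ : ℝ, Tendsto (fun n : ℕ => (finrank K ↥(𝒜 n) : ℝ) / (n : ℝ) ^ e) atTop
      (nhds ℓ) := by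
    refine exists_tendsto_of_forall_eventually_approx fun ε h0 h1 => ?_
    obtain ⟨p₀, -, hp₀⟩ := happr' ε h0 h1
    obtain ⟨p, hpm, hp⟩ : ∃ p, p ≥ max N q ∧ p ≥ p₀ :=
      ⟨max (max N q) p₀, le_max_left _ _, le_max_right _ _⟩
    have hp1 := hpos p hpm
    have hpN' : N ≤ p := (le_max_left _ _).trans hpm
    have hp1' : (1 : ℝ) ≤ p := by exact_mod_cast hp1
    have hlimp := hlim p hpm
    rw [hd p hpm] at hlimp
    have hdiv : Tendsto (fun n : ℕ => n / p) atTop atTop := Nat.tendsto_div_const_atTop hp1.ne'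
    have hlow := tendsto_comp_div_pow hlimp hp1 (m := fun n => n / p - 1) (C := 2 * p) (by
      filter_upwards [hdiv.eventually_ge_atTop 1] with n hn
      have h2 : ((n / p : ℕ) : ℝ) * p + (n % p : ℕ) = n := by exact_mod_cast Nat.div_add_mod' n p
      have h3 : ((n % p : ℕ) : ℝ) ≤ p := by exact_mod_cast (Nat.mod_lt n hp1).le
      have h4 : (0 : ℝ) ≤ (n % p : ℕ) := Nat.cast_nonneg _
      rw [Nat.cast_sub hn, Nat.cast_one, abs_le]
      constructor <;> linarith)
    have hup := tendsto_comp_div_pow hlimp hp1 (m := fun n => n / p + 2) (C := 2 * p) (by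
      refine Eventually.of_forall fun n => ?_
      have h2 : ((n / p : ℕ) : ℝ) * p + (n % p : ℕ) = n := by exact_mod_cast Nat.div_add_mod' n p
      have h3 : ((n % p : ℕ) : ℝ) ≤ p := by exact_mod_cast (Nat.mod_lt n hp1).le
      have h4 : (0 : ℝ) ≤ (n % p : ℕ) := Nat.cast_nonneg _
      push_cast
      rw [abs_le]
      constructor <;> linarith)
    refine ⟨c p / (p : ℝ) ^ e, fun η hη => ?_⟩
    filter_upwards [hlow.eventually_const_le (sub_lt_self _ hη),
      hup.eventually_le_const (lt_add_of_pos_right _ hη), hdiv.eventually_ge_atTop 1,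
      ((tendsto_add_atTop_nat 2).comp hdiv).eventually (hp₀ p hp)] with n hl hu hn ha
    have hmod := Nat.mod_lt n hp1
    have hdm := Nat.div_add_mod' n p
    constructor
    · refine hl.trans ?_
      gcongr
      refine (hle p _).trans ?_
      have heq : n = (n / p - 1) * p + (p + n % p) := by
        obtain ⟨t, ht⟩ := Nat.exists_eq_add_of_le' hn
        rw [ht, Nat.add_sub_cancel]
        rw [ht] at hdm
        linarith
      have h := finrank_graded_le_add 𝒜 hfin ((n / p - 1) * p) (hN (p + n % p) (by omega))
      rwa [← heq] at h
    · refine le_trans ?_ hu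
      rw [← mul_div_assoc]
      gcongr
      rw [Function.comp_apply] at ha
      refine le_trans ?_ ha
      have heq : (n / p + 2) * p = n + (2 * p - n % p) := by
        rw [add_mul]
        omega
      rw [heq]
      have h := finrank_graded_le_add 𝒜 hfin n (hN (2 * p - n % p) (by omega))
      have : 0 ≤ 1 - ε := by linarith
      gcongr
  obtain ⟨ℓ, hℓ⟩ := hconv
  refine ⟨e + 1, e.succ_pos, ⟨max N q, fun p hp => by rw [hdim p hp, hd p hp]⟩,
    ℓ * e.factorial, ?_, ?_⟩
  · exact mul_nonneg (ge_of_tendsto' hℓ fun n => by positivity) (Nat.cast_nonneg _)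
  · rw [Nat.add_sub_cancel]
    exact (hℓ.mul_const _).congr fun n => div_mul_eq_mul_div _ _ _
end

section
/- Let B be an approximable integral graded K-algebra. Then for every r ∈ ℕ, lim_{n→∞} rank(B_{n+r})/rank(B_n) = 1. -/
open Module Filter

/-- The indices of a finite family `f` whose value is not spanned by the values at smaller indices. -/
noncomputable def greedyIndices (K : Type*) {V ι : Type*} [Field K] [AddCommGroup V] [Module K V]
    [LinearOrder ι] (f : ι → V) (s : Finset ι) : Finset ι :=
  open Classical in {a ∈ s | f a ∉ Submodule.span K (f '' {b | b ∈ s ∧ b < a})}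

section Greedy

variable {K V ι : Type*} [Field K] [AddCommGroup V] [Module K V] [LinearOrder ι]

theorem mem_greedyIndices {f : ι → V} {s : Finset ι} {a : ι} :
    a ∈ greedyIndices K f s ↔
      a ∈ s ∧ f a ∉ Submodule.span K (f '' {b | b ∈ s ∧ b < a}) := by
  simp [greedyIndices]

theorem linearIndepOn_greedyIndices_and_span_eq (f : ι → V) (s : Finset ι) :
    LinearIndepOn K f (greedyIndices K f s : Set ι) ∧
      Submodule.span K (f '' (greedyIndices K f s : Set ι)) =
        Submodule.span K (f '' (s : Set ι)) := by
  induction s using Finset.induction_on_max with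
  | empty => simp [greedyIndices]
  | insert x s hx ih =>
    obtain ⟨hli, hspan⟩ := ih
    have hxs : x ∉ s := fun h => (hx x h).false
    have below : {b | b ∈ insert x s ∧ b < x} = (s : Set ι) := by
      ext b
      have := hx b
      simp only [Finset.mem_insert, Set.mem_ofPred_eq, Finset.mem_coe]
      grind
    have below' : ∀ a ∈ s, {b | b ∈ insert x s ∧ b < a} = {b | b ∈ s ∧ b < a} := by
      intro a ha
      ext b
      have := hx a ha
      simp only [Finset.mem_insert, Set.mem_ofPred_eq]
      grind
    by_cases hfx : f x ∈ Submodule.span K (f '' (s : Set ι))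
    · have hQ : greedyIndices K f (insert x s) = greedyIndices K f s := by
        ext a
        rw [mem_greedyIndices, mem_greedyIndices]
        by_cases hax : a = x
        · subst hax
          rw [below]
          simp [hfx, hxs]
        · by_cases ha : a ∈ s
          · rw [below' a ha]
            simp [ha]
          · simp [ha, hax]
      rw [hQ, Finset.coe_insert, Set.image_insert_eq, Submodule.span_insert_eq_span hfx]
      exact ⟨hli, hspan⟩
    · have hQ : greedyIndices K f (insert x s) = insert x (greedyIndices K f s) := by
        ext a
        rw [Finset.mem_insert, mem_greedyIndices, mem_greedyIndices]
        by_cases hax : a = x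
        · subst hax
          rw [below]
          simp [hfx]
        · by_cases ha : a ∈ s
          · rw [below' a ha]
            simp [ha, hax]
          · simp [ha, hax]
      rw [hQ, Finset.coe_insert, Finset.coe_insert, Set.image_insert_eq, Set.image_insert_eq,
        Submodule.span_insert, Submodule.span_insert, hspan]
      refine ⟨?_, rfl⟩
      rw [linearIndepOn_insert (fun h => hxs (mem_greedyIndices.1 (Finset.mem_coe.1 h)).1), hspan]
      exact ⟨hli, hfx⟩

theorem finrank_span_image_eq_card_greedyIndices (f : ι → V) (s : Finset ι) :
    finrank K (Submodule.span K (f '' (s : Set ι))) = (greedyIndices K f s).card := by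
  obtain ⟨hli, hspan⟩ := linearIndepOn_greedyIndices_and_span_eq (K := K) f s
  rw [← hspan, Set.image_eq_range]
  exact (finrank_span_eq_card (b := fun i : greedyIndices K f s => f i) hli).trans
    (Fintype.card_coe _)

end Greedy

section Monomials

variable {K A : Type*} [Field K] [CommRing A] [Algebra K A] {t : ℕ}

/-- Exponent vectors of total degree `k`, ordered lexicographically. -/
def exponents (t k : ℕ) : Finset (Lex (Fin t → ℕ)) :=
  (Finset.piAntidiag Finset.univ k).map toLex.toEmbedding

theorem mem_exponents {k : ℕ} {a : Lex (Fin t → ℕ)} :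
    a ∈ exponents t k ↔ ∑ i, ofLex a i = k := by
  simp only [exponents, Finset.mem_map_equiv, Finset.mem_piAntidiag]
  simp
  rfl

/-- The monomial with exponent vector `a` evaluated at `v`. -/
def monomialEval (v : Fin t → A) (a : Lex (Fin t → ℕ)) : A := ∏ i, v i ^ ofLex a i

/-- The exponent vector of a single variable. -/
def unitExponent (i : Fin t) : Lex (Fin t → ℕ) := toLex (Pi.single i 1)

theorem add_unitExponent_apply (a : Lex (Fin t → ℕ)) (i j : Fin t) :
    ofLex (a + unitExponent i) j = ofLex a j + if j = i then 1 else 0 :=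
  congrArg (ofLex a j + ·) (Pi.single_apply i 1 j)

theorem monomialEval_add_unitExponent (v : Fin t → A) (a : Lex (Fin t → ℕ)) (i : Fin t) :
    monomialEval v (a + unitExponent i) = monomialEval v a * v i := by
  simp only [monomialEval, add_unitExponent_apply, pow_add, Finset.prod_mul_distrib]
  simp [pow_ite]

theorem add_unitExponent_mem_exponents {k : ℕ} {a : Lex (Fin t → ℕ)} {i : Fin t} :
    a + unitExponent i ∈ exponents t (k + 1) ↔ a ∈ exponents t k := by
  simp [-Pi.ofLex_apply, mem_exponents, add_unitExponent_apply, Finset.sum_add_distrib]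

theorem exists_eq_add_unitExponent {b : Lex (Fin t → ℕ)} {i : Fin t} (h : ofLex b i ≠ 0) :
    ∃ a, b = a + unitExponent i := by
  refine ⟨toLex (ofLex b - Pi.single i 1), ofLex.injective (funext fun j => ?_)⟩
  rw [add_unitExponent_apply]
  change ofLex b j = ofLex b j - (Pi.single i 1 : Fin t → ℕ) j + _
  rw [Pi.single_apply]
  split_ifs with hj
  · subst hj
    omega
  · rfl

theorem span_range_pow_eq_s4 (v : Fin t → A) (k : ℕ) :
    Submodule.span K (Set.range v) ^ k =
      Submodule.span K (monomialEval v '' (exponents t k : Set (Lex (Fin t → ℕ)))) := by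
  induction k with
  | zero =>
    have h : (exponents t 0 : Set (Lex (Fin t → ℕ))) = {0} := by
      ext a
      simp only [Finset.mem_coe, mem_exponents, Finset.sum_eq_zero_iff, Finset.mem_univ,
        true_implies, Set.mem_singleton_iff]
      exact ⟨fun h => ofLex.injective (funext h), fun h i => congrFun h i⟩
    have h1 : monomialEval v 0 = 1 := Finset.prod_eq_one fun i _ => pow_zero (v i)
    simp [h, h1, Submodule.one_eq_span]
  | succ k ih =>
    rw [pow_succ, ih, Submodule.span_mul_span]
    apply le_antisymm <;> rw [Submodule.span_le]
    · rintro _ ⟨_, ⟨a, ha, rfl⟩, _, ⟨i, rfl⟩, rfl⟩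
      refine Submodule.subset_span ⟨a + unitExponent i, ?_, monomialEval_add_unitExponent v a i⟩
      exact add_unitExponent_mem_exponents.2 ha
    · rintro _ ⟨b, hb, rfl⟩
      obtain ⟨i, hi⟩ : ∃ i, ofLex b i ≠ 0 := by
        by_contra! h
        have := mem_exponents.1 (Finset.mem_coe.1 hb)
        simp [h] at this
      obtain ⟨a, rfl⟩ := exists_eq_add_unitExponent hi
      rw [monomialEval_add_unitExponent]
      exact Submodule.subset_span ⟨_, ⟨a, add_unitExponent_mem_exponents.1 hb, rfl⟩, _, ⟨i, rfl⟩, rfl⟩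

theorem mem_greedyIndices_of_add_unitExponent (v : Fin t → A) {k : ℕ} {a : Lex (Fin t → ℕ)}
    {i : Fin t}
    (h : a + unitExponent i ∈ greedyIndices K (monomialEval v) (exponents t (k + 1))) :
    a ∈ greedyIndices K (monomialEval v) (exponents t k) := by
  rw [mem_greedyIndices, add_unitExponent_mem_exponents] at h
  refine mem_greedyIndices.2 ⟨h.1, fun ha => h.2 ?_⟩
  rw [monomialEval_add_unitExponent]
  have := Submodule.mul_mem_mul ha (Submodule.subset_span (R := K) (Set.mem_singleton (v i)))
  rw [Submodule.span_mul_span] at this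
  refine Submodule.span_mono ?_ this
  rintro _ ⟨_, ⟨b, hb, rfl⟩, _, rfl, rfl⟩
  exact ⟨b + unitExponent i, ⟨add_unitExponent_mem_exponents.2 hb.1, by gcongr; exact hb.2⟩,
    monomialEval_add_unitExponent v b i⟩

theorem succ_mul_card_greedyIndices_le (v : Fin t → A) (k : ℕ) :
    (k + 1) * (greedyIndices K (monomialEval v) (exponents t (k + 1))).card ≤
      (k + t) * (greedyIndices K (monomialEval v) (exponents t k)).card := by
  set P := greedyIndices K (monomialEval v) (exponents t (k + 1)) with hP
  set Q := greedyIndices K (monomialEval v) (exponents t k) with hQ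
  have hPdeg : ∀ b ∈ P, ∑ i, ofLex b i = k + 1 := fun b hb =>
    mem_exponents.1 (mem_greedyIndices.1 hb).1
  have hQdeg : ∀ a ∈ Q, ∑ i, ofLex a i = k := fun a ha =>
    mem_exponents.1 (mem_greedyIndices.1 ha).1
  have key : ∀ i, ∑ b ∈ P, ofLex b i ≤ ∑ a ∈ Q, (ofLex a i + 1) := by
    intro i
    have himage : ∑ a ∈ Q, (ofLex a i + 1) =
        ∑ b ∈ Q.image (· + unitExponent i), ofLex b i := by
      rw [Finset.sum_image fun _ _ _ _ h => add_right_cancel h]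
      simp [-Pi.ofLex_apply, add_unitExponent_apply]
    rw [himage]
    refine Finset.sum_le_sum_of_ne_zero fun b hb hbi => ?_
    obtain ⟨a, rfl⟩ := exists_eq_add_unitExponent hbi
    exact Finset.mem_image_of_mem _ (mem_greedyIndices_of_add_unitExponent v hb)
  calc (k + 1) * P.card = ∑ b ∈ P, ∑ i, ofLex b i := by
        rw [Finset.sum_congr rfl hPdeg, Finset.sum_const, smul_eq_mul, mul_comm]
    _ = ∑ i, ∑ b ∈ P, ofLex b i := Finset.sum_comm
    _ ≤ ∑ i, ∑ a ∈ Q, (ofLex a i + 1) := Finset.sum_le_sum fun i _ => key i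
    _ = ∑ a ∈ Q, ∑ i, (ofLex a i + 1) := Finset.sum_comm
    _ = ∑ a ∈ Q, (k + t) := Finset.sum_congr rfl fun a ha => by
        rw [Finset.sum_add_distrib, hQdeg a ha]
        simp
    _ = (k + t) * Q.card := by rw [Finset.sum_const, smul_eq_mul, mul_comm]

/-- Growth bound for the Hilbert function of a standard graded algebra. -/
theorem succ_mul_finrank_pow_succ_le (V : Submodule K A) [FiniteDimensional K V] (k : ℕ) :
    (k + 1) * finrank K ↥(V ^ (k + 1)) ≤ (k + finrank K V) * finrank K ↥(V ^ k) := by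
  let v : Fin (finrank K V) → A := fun i => (finBasis K V i : A)
  have hv : Submodule.span K (Set.range v) = V := by
    have h := congrArg (Submodule.map V.subtype) (finBasis K V).span_eq
    rw [Submodule.map_span, ← Set.range_comp, Submodule.map_top, Submodule.range_subtype] at h
    exact h
  have h := succ_mul_card_greedyIndices_le (K := K) v k
  rw [← finrank_span_image_eq_card_greedyIndices, ← finrank_span_image_eq_card_greedyIndices,
    ← span_range_pow_eq_s4, ← span_range_pow_eq_s4, hv] at h
  exact h

theorem finrank_pow_add_le (V : Submodule K A) [FiniteDimensional K V] (c k : ℕ) :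
    (finrank K ↥(V ^ (k + c)) : ℝ) ≤
      (1 + finrank K V / ((k : ℝ) + 1)) ^ c * finrank K ↥(V ^ k) := by
  induction c with
  | zero => simp
  | succ c ih =>
    have h : ((k + c : ℕ) + 1 : ℝ) * finrank K ↥(V ^ (k + c + 1)) ≤
        ((k + c : ℕ) + finrank K V) * finrank K ↥(V ^ (k + c)) := by
      exact_mod_cast succ_mul_finrank_pow_succ_le V (k + c)
    have hk : (0 : ℝ) < ((k + c : ℕ) : ℝ) + 1 := by positivity
    calc (finrank K ↥(V ^ (k + (c + 1))) : ℝ)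
        ≤ (((k + c : ℕ) + finrank K V) / ((k + c : ℕ) + 1)) * finrank K ↥(V ^ (k + c)) := by
          rw [div_mul_eq_mul_div, le_div_iff₀ hk, mul_comm]
          exact h
      _ ≤ (1 + finrank K V / ((k : ℝ) + 1)) * finrank K ↥(V ^ (k + c)) := by
          gcongr
          calc (((k + c : ℕ) : ℝ) + finrank K V) / ((k + c : ℕ) + 1)
              ≤ (((k + c : ℕ) + 1) + finrank K V) / ((k + c : ℕ) + 1) := by gcongr; linarith
            _ = 1 + finrank K V / (((k + c : ℕ) : ℝ) + 1) := by field_simp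
            _ ≤ _ := by gcongr; omega
      _ ≤ (1 + finrank K V / ((k : ℝ) + 1)) *
          ((1 + finrank K V / ((k : ℝ) + 1)) ^ c * finrank K ↥(V ^ k)) := by gcongr
      _ = _ := by ring

theorem eventually_finrank_pow_add_le (V : Submodule K A) [FiniteDimensional K V] (c : ℕ)
    {b : ℝ} (hb : 1 < b) :
    ∀ᶠ k : ℕ in atTop, (finrank K ↥(V ^ (k + c)) : ℝ) ≤ b * finrank K ↥(V ^ k) := by
  have hlim : Tendsto (fun k : ℕ => (1 + (finrank K V : ℝ) / ((k : ℝ) + 1)) ^ c) atTop (nhds 1) := by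
    have h : Tendsto (fun k : ℕ => (finrank K V : ℝ) / ((k : ℝ) + 1)) atTop (nhds 0) :=
      tendsto_const_nhds.div_atTop
        (tendsto_atTop_add_const_right _ _ tendsto_natCast_atTop_atTop)
    simpa using (h.const_add 1).pow c
  filter_upwards [hlim.eventually_le_const hb] with k hk
  exact (finrank_pow_add_le V c k).trans (by gcongr)

end Monomials

section Graded

variable {K A : Type*} [Field K] [CommRing A] [Algebra K A]
  (𝒜 : ℕ → Submodule K A)

theorem graded_pow_le [GradedAlgebra 𝒜] (p n : ℕ) : 𝒜 p ^ n ≤ 𝒜 (n * p) := by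
  induction n with
  | zero => simpa [Submodule.one_le] using SetLike.GradedOne.one_mem (A := 𝒜)
  | succ n ih =>
    rw [pow_succ, Nat.succ_mul]
    refine (mul_le_mul_left ih _).trans (Submodule.mul_le.2 fun a ha b hb => ?_)
    exact SetLike.GradedMul.mul_mem ha hb

theorem finrank_le_finrank_add [IsDomain A] [GradedAlgebra 𝒜]
    (hfin : ∀ n, FiniteDimensional K ↥(𝒜 n)) {s : ℕ} (hs : 𝒜 s ≠ ⊥) (n : ℕ) :
    finrank K ↥(𝒜 n) ≤ finrank K ↥(𝒜 (n + s)) := by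
  obtain ⟨x, hx, hx0⟩ := (𝒜 s).ne_bot_iff.1 hs
  have := hfin (n + s)
  let φ : 𝒜 n →ₗ[K] 𝒜 (n + s) :=
    ((LinearMap.mulRight K x).comp (𝒜 n).subtype).codRestrict (𝒜 (n + s))
      fun a => SetLike.GradedMul.mul_mem a.2 hx
  refine LinearMap.finrank_le_finrank_of_injective (f := φ) fun a b hab => Subtype.ext ?_
  exact mul_right_cancel₀ hx0 (congrArg Subtype.val hab)

/-- Given approximability in one degree `p`, the dimensions cannot grow by much more than
the factor `(1 - ε)⁻¹` over a bounded shift of degree. -/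
theorem eventually_finrank_add_le [IsDomain A] [GradedAlgebra 𝒜]
    (hfin : ∀ n, FiniteDimensional K ↥(𝒜 n)) {N p : ℕ} (hN : ∀ n ≥ N, 𝒜 n ≠ ⊥)
    (hp : 1 ≤ p) (hNp : N ≤ p) {ε δ : ℝ} (hε : ε < 1) (hδ : 1 < (1 - ε) * (1 + δ))
    (hliminf : (1 - ε) < Filter.liminf
        (fun n : ℕ => (finrank K ↥((𝒜 p) ^ n) : ℝ) / (finrank K ↥(𝒜 (n * p)) : ℝ))
        Filter.atTop) (r : ℕ) :
    ∀ᶠ n : ℕ in atTop, (finrank K ↥(𝒜 (n + r)) : ℝ) ≤ (1 + δ) * finrank K ↥(𝒜 n) := by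
  have hfrac := eventually_lt_of_lt_liminf hliminf
    (isBoundedUnder_of ⟨0, fun n => by positivity⟩)
  set c := r + N + 2 with hc
  have hev := (eventually_finrank_pow_add_le (𝒜 p) c hδ).and
    ((tendsto_add_atTop_nat c).eventually hfrac)
  have hq : Tendsto (fun n : ℕ => n / p - 1) atTop atTop :=
    (tendsto_sub_atTop_nat 1).comp (Nat.tendsto_div_const_atTop (by omega))
  filter_upwards [hq.eventually hev, eventually_ge_atTop p] with n hn hnp
  obtain ⟨hpow, hlt⟩ := hn
  set k := n / p - 1 with hk
  have hquot : 1 ≤ n / p := (Nat.one_le_div_iff hp).2 hnp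
  have hkp : (k + 1) * p ≤ n := by
    rw [hk, Nat.sub_add_cancel hquot]
    exact Nat.div_mul_le_self n p
  have hkp' : n < (k + 2) * p := by
    have := Nat.lt_div_mul_add (a := n) hp
    have h2 : k + 2 = n / p + 1 := by omega
    rw [h2, add_mul, one_mul]
    exact this
  have hkn : finrank K ↥(𝒜 (k * p)) ≤ finrank K ↥(𝒜 n) := by
    have h : k * p + (n - k * p) = n := by rw [add_mul] at hkp; omega
    conv_rhs => rw [← h]
    refine finrank_le_finrank_add 𝒜 hfin (hN _ ?_) _
    rw [add_mul] at hkp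
    omega
  have hnm : finrank K ↥(𝒜 (n + r)) ≤ finrank K ↥(𝒜 ((k + c) * p)) := by
    have h1 : n + r + N ≤ (k + c) * p := by
      have : r + N ≤ (r + N) * p := Nat.le_mul_of_pos_right _ hp
      have : (k + c) * p = (k + 2) * p + (r + N) * p := by rw [hc]; ring
      omega
    have h : n + r + ((k + c) * p - (n + r)) = (k + c) * p := by omega
    rw [← h]
    exact finrank_le_finrank_add 𝒜 hfin (hN _ (by omega)) _
  have hsub : finrank K ↥(𝒜 p ^ k) ≤ finrank K ↥(𝒜 (k * p)) :=
    have := hfin (k * p)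
    Submodule.finrank_mono (graded_pow_le 𝒜 p k)
  have hlow : (1 - ε) * finrank K ↥(𝒜 ((k + c) * p)) ≤ finrank K ↥(𝒜 p ^ (k + c)) :=
    mul_le_of_le_div₀ (by positivity) (by positivity) hlt.le
  have hε' : 0 < 1 - ε := by linarith
  refine le_of_mul_le_mul_left ?_ hε'
  calc (1 - ε) * (finrank K ↥(𝒜 (n + r)) : ℝ)
      ≤ (1 - ε) * finrank K ↥(𝒜 ((k + c) * p)) := by gcongr
    _ ≤ finrank K ↥(𝒜 p ^ (k + c)) := hlow
    _ ≤ (1 - ε) * (1 + δ) * finrank K ↥(𝒜 p ^ k) := hpow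
    _ ≤ (1 - ε) * (1 + δ) * finrank K ↥(𝒜 n) := by
        gcongr
        exact hsub.trans hkn
    _ = (1 - ε) * ((1 + δ) * finrank K ↥(𝒜 n)) := by ring

end Graded

/-- If `B = ⊕ₙ Bₙ` (graded pieces `𝒜 n` of a graded domain)
is an approximable integral graded `K`-algebra, then for every `r ∈ ℕ`,
`rank B_{n+r} / rank B_n → 1` as `n → ∞`. -/
theorem stmt4 {K A : Type*} [Field K] [CommRing A] [IsDomain A] [Algebra K A]
    (𝒜 : ℕ → Submodule K A) [GradedAlgebra 𝒜]
    (hfin : ∀ n, FiniteDimensional K ↥(𝒜 n))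
    (hne : ∃ N : ℕ, ∀ n ≥ N, 𝒜 n ≠ ⊥)
    (happr : ∀ ε : ℝ, 0 < ε → ε < 1 → ∃ p₀ : ℕ, 1 ≤ p₀ ∧ ∀ p ≥ p₀,
      (1 - ε) < Filter.liminf
        (fun n : ℕ => (finrank K ↥((𝒜 p) ^ n) : ℝ) / (finrank K ↥(𝒜 (n * p)) : ℝ))
        Filter.atTop) :
    ∀ r : ℕ, Filter.Tendsto
      (fun n : ℕ => (finrank K ↥(𝒜 (n + r)) : ℝ) / (finrank K ↥(𝒜 n) : ℝ))
      Filter.atTop (nhds 1) := by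
  obtain ⟨N, hN⟩ := hne
  have hpos : ∀ n ≥ N, (0 : ℝ) < finrank K ↥(𝒜 n) := fun n hn => by
    have := hfin n
    exact_mod_cast Nat.pos_of_ne_zero (mt Submodule.finrank_eq_zero.1 (hN n hn))
  have hupper : ∀ (r : ℕ) (δ : ℝ), 0 < δ → ∀ᶠ n : ℕ in atTop,
      (finrank K ↥(𝒜 (n + r)) : ℝ) ≤ (1 + δ) * finrank K ↥(𝒜 n) := by
    intro r δ hδ
    have hε1 : δ / (2 * (1 + δ)) < 1 := by
      rw [div_lt_one (by positivity)]
      linarith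
    obtain ⟨p₀, hp₀, h⟩ := happr (δ / (2 * (1 + δ))) (by positivity) hε1
    have hgt : 1 < (1 - δ / (2 * (1 + δ))) * (1 + δ) := by
      have : (1 - δ / (2 * (1 + δ))) * (1 + δ) = 1 + δ / 2 := by
        field_simp
        ring
      linarith
    exact eventually_finrank_add_le 𝒜 hfin hN (hp₀.trans (le_max_left p₀ N)) (le_max_right p₀ N)
      hε1 hgt (h _ (le_max_left p₀ N)) r
  intro r
  rw [tendsto_order]
  constructor
  · intro a ha
    obtain ⟨b, hab, hb⟩ : ∃ b, max a 0 < b ∧ b < 1 := exists_between (max_lt ha one_pos)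
    have hb0 : 0 < b := (le_max_right a 0).trans_lt hab
    have hδ : 0 < b⁻¹ - 1 := sub_pos.2 ((one_lt_inv₀ hb0).2 hb)
    filter_upwards [(tendsto_add_atTop_nat r).eventually (hupper N _ hδ),
      eventually_ge_atTop N] with n hn hnN
    have hle : (finrank K ↥(𝒜 n) : ℝ) ≤ finrank K ↥(𝒜 (n + r + N)) := by
      rw [add_assoc]
      exact_mod_cast finrank_le_finrank_add 𝒜 hfin (hN (r + N) (by omega)) n
    refine ((le_max_left a 0).trans_lt hab).trans_le ?_
    rw [le_div_iff₀ (hpos n hnN), ← le_inv_mul_iff₀ hb0]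
    calc (finrank K ↥(𝒜 n) : ℝ) ≤ _ := hle.trans hn
      _ = _ := by ring
  · intro a ha
    obtain ⟨b, hb, hba⟩ := exists_between ha
    filter_upwards [hupper r (b - 1) (sub_pos.2 hb), eventually_ge_atTop N] with n hn hnN
    refine lt_of_le_of_lt ?_ hba
    rw [div_le_iff₀ (hpos n hnN)]
    simpa using hn
end
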